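/- Let a, b ∈ ℂ, let P₂₃ be the 3×3 permutation matrix [[1,0,0],[0,0,1],[0,1,0]], let E be the 3×3 matrix with all entries equal to 1/3, and let U_TBM be the tri-bimaximal matrix with columns v₁ = (√(2/3), −1/√6, −1/√6)ᵀ, v₂ = (1/√3, 1/√3, 1/√3)ᵀ, v₃ = (0, 1/√2, −1/√2)ᵀ. Then U_TBMᵀ · (a·P₂₃ + b·E) · U_TBM = diag(a, a+b, −a); in particular U_TBM is orthogonal and the matrix a·P₂₃ + b·E has eigenvalues m₁ = a, m₂ = a + b, m₃ = −a with eigenvectors v₁, v₂, v₃ respectively. -/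

import Mathlib

open Matrix

/-- The μ–τ permutation matrix `P₂₃`. -/
noncomputable def P23 : Matrix (Fin 3) (Fin 3) ℂ := !![1, 0, 0; 0, 0, 1; 0, 1, 0]

/-- The democratic projector `E` with all entries `1/3`. -/
noncomputable def demE : Matrix (Fin 3) (Fin 3) ℂ := Matrix.of fun _ _ => (1 / 3 : ℂ)

/-- First tri-bimaximal column `v₁ = (√(2/3), −1/√6, −1/√6)ᵀ`. -/
noncomputable def tbmV1 : Fin 3 → ℂ :=
  ![(Real.sqrt (2 / 3) : ℝ), -(1 / Real.sqrt 6 : ℝ), -(1 / Real.sqrt 6 : ℝ)]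

/-- Second tri-bimaximal column `v₂ = (1/√3, 1/√3, 1/√3)ᵀ`. -/
noncomputable def tbmV2 : Fin 3 → ℂ :=
  ![(1 / Real.sqrt 3 : ℝ), (1 / Real.sqrt 3 : ℝ), (1 / Real.sqrt 3 : ℝ)]

/-- Third tri-bimaximal column `v₃ = (0, 1/√2, −1/√2)ᵀ`. -/
noncomputable def tbmV3 : Fin 3 → ℂ :=
  ![0, (1 / Real.sqrt 2 : ℝ), -(1 / Real.sqrt 2 : ℝ)]

/-- The tri-bimaximal mixing matrix, whose columns are `v₁, v₂, v₃`. -/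
noncomputable def UTBM : Matrix (Fin 3) (Fin 3) ℂ :=
  Matrix.of fun i => ![tbmV1 i, tbmV2 i, tbmV3 i]

theorem tbmV1_eq : tbmV1 = ((1 / Real.sqrt 6 : ℝ) : ℂ) • ![2, -1, -1] := by
  have h : Real.sqrt (2 / 3) = 1 / Real.sqrt 6 * 2 := by
    rw [Real.sqrt_eq_iff_mul_self_eq (by norm_num) (by positivity)]
    have h6 : Real.sqrt 6 ^ 2 = 6 := Real.sq_sqrt (by norm_num)
    field_simp
    rw [h6]
    norm_num
  ext i
  fin_cases i <;> simp [tbmV1, h]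

theorem tbmV2_eq : tbmV2 = ((1 / Real.sqrt 3 : ℝ) : ℂ) • ![1, 1, 1] := by
  ext i
  fin_cases i <;> simp [tbmV2]

theorem tbmV3_eq : tbmV3 = ((1 / Real.sqrt 2 : ℝ) : ℂ) • ![0, 1, -1] := by
  ext i
  fin_cases i <;> simp [tbmV3]

theorem ofReal_one_div_sqrt_mul_self {x : ℝ} (hx : 0 ≤ x) :
    ((1 / Real.sqrt x : ℝ) : ℂ) * ((1 / Real.sqrt x : ℝ) : ℂ) = ((1 / x : ℝ) : ℂ) := by
  rw [← Complex.ofReal_mul, div_mul_div_comm, Real.mul_self_sqrt hx, one_mul]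

theorem mulVec_tbmV1 (a b : ℂ) : (a • P23 + b • demE).mulVec tbmV1 = a • tbmV1 := by
  rw [tbmV1_eq, mulVec_smul, smul_comm a]
  congr 1
  ext i
  fin_cases i <;> simp [P23, demE, mulVec, dotProduct, Fin.sum_univ_three] <;> ring

theorem mulVec_tbmV2 (a b : ℂ) : (a • P23 + b • demE).mulVec tbmV2 = (a + b) • tbmV2 := by
  rw [tbmV2_eq, mulVec_smul, smul_comm (a + b)]
  congr 1
  ext i
  fin_cases i <;> simp [P23, demE, mulVec, dotProduct, Fin.sum_univ_three] <;> ring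

theorem mulVec_tbmV3 (a b : ℂ) : (a • P23 + b • demE).mulVec tbmV3 = (-a) • tbmV3 := by
  rw [tbmV3_eq, mulVec_smul, smul_comm (-a)]
  congr 1
  ext i
  fin_cases i <;> simp [P23, demE, mulVec, dotProduct, Fin.sum_univ_three]

theorem UTBM_transpose_mul_self : UTBMᵀ * UTBM = 1 := by
  have h (i j : Fin 3) : (UTBMᵀ * UTBM) i j =
      ![tbmV1, tbmV2, tbmV3] i ⬝ᵥ ![tbmV1, tbmV2, tbmV3] j := by
    fin_cases i <;> fin_cases j <;> rfl
  have h6 := ofReal_one_div_sqrt_mul_self (x := 6) (by norm_num)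
  have h3 := ofReal_one_div_sqrt_mul_self (x := 3) (by norm_num)
  have h2 := ofReal_one_div_sqrt_mul_self (x := 2) (by norm_num)
  ext i j
  rw [h, tbmV1_eq, tbmV2_eq, tbmV3_eq]
  fin_cases i <;> fin_cases j <;>
    simp only [Fin.zero_eta, Fin.mk_one, Fin.reduceFinMk, cons_val, smul_dotProduct,
      dotProduct_smul, vec3_dotProduct', smul_smul, h6, h3, h2] <;>
    norm_num

theorem mul_UTBM (a b : ℂ) :
    (a • P23 + b • demE) * UTBM = UTBM * diagonal ![a, a + b, -a] := by
  ext i j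
  rw [mul_diagonal]
  fin_cases j
  · exact (congrFun (mulVec_tbmV1 a b) i).trans (mul_comm _ _)
  · exact (congrFun (mulVec_tbmV2 a b) i).trans (mul_comm _ _)
  · exact (congrFun (mulVec_tbmV3 a b) i).trans (mul_comm _ _)

/-- **Leading-order `A₄` diagonalization.** For any `a, b ∈ ℂ`, the matrix
`a·P₂₃ + b·E` satisfies `U_TBMᵀ · (a·P₂₃ + b·E) · U_TBM = diag(a, a+b, −a)`; in
particular `U_TBM` is orthogonal and `a·P₂₃ + b·E` has eigenvalues `a`, `a+b`, `−a`
with eigenvectors `v₁`, `v₂`, `v₃` respectively. -/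
theorem A4_LO_diagonalization (a b : ℂ) :
    UTBMᵀ * (a • P23 + b • demE) * UTBM = Matrix.diagonal ![a, a + b, -a] ∧
    UTBMᵀ * UTBM = 1 ∧
    (a • P23 + b • demE).mulVec tbmV1 = a • tbmV1 ∧
    (a • P23 + b • demE).mulVec tbmV2 = (a + b) • tbmV2 ∧
    (a • P23 + b • demE).mulVec tbmV3 = (-a) • tbmV3 := by
  refine ⟨?_, UTBM_transpose_mul_self, mulVec_tbmV1 a b, mulVec_tbmV2 a b, mulVec_tbmV3 a b⟩
  rw [Matrix.mul_assoc, mul_UTBM, ← Matrix.mul_assoc, UTBM_transpose_mul_self, Matrix.one_mul]
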